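/- Let G be a planar ribbon graph such that G and its planar dual G* are both loopless. Then the rotor-routing actions are compatible with plane duality: for every sandpile group element [D] ∈ Jac(G) and every spanning tree T of G, one has δ([D] · T) = φ([D]) · δ(T), where on the left · denotes the rotor-routing action of Jac(G) on spanning trees of G and on the right · denotes the rotor-routing action of Jac(G*) on spanning trees of G*. Equivalently, the square formed by μ_G, μ_{G*}, φ × δ, and δ commutes. -/

import Mathlib

attribute [local instance 10] Classical.propDecidable

/-- A finite multigraph, presented by darts (oriented edges): `rev` is the
fixed-point-free involution exchanging the two darts of each edge, and
`head d` is the vertex the dart `d` points to. -/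
structure Multigraph where
  V : Type
  D : Type
  fV : Fintype V
  dV : DecidableEq V
  fD : Fintype D
  dD : DecidableEq D
  rev : D → D
  rev_invol : Function.Involutive rev
  rev_ne : ∀ d : D, rev d ≠ d
  head : D → V

attribute [instance] Multigraph.fV Multigraph.dV Multigraph.fD Multigraph.dD

namespace Multigraph

variable (G : Multigraph)

/-- The tail (starting vertex) of a dart. -/
def tail (d : G.D) : G.V := G.head (G.rev d)

/-- `G` is loopless: no edge has equal endpoints. -/
def Loopless : Prop := ∀ d : G.D, G.head d ≠ G.tail d

/-- One-step adjacency between vertices. -/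
def Adj (u v : G.V) : Prop := ∃ d : G.D, G.tail d = u ∧ G.head d = v

/-- `G` is connected. -/
def Connected : Prop := ∀ u v : G.V, Relation.ReflTransGen G.Adj u v

/-- The degree of a vertex: the number of darts with tail `v`. -/
def degree (v : G.V) : ℕ := (Finset.univ.filter fun d : G.D => G.tail d = v).card

/-- The number of edges joining `v` to `w`. -/
def mul (v w : G.V) : ℕ :=
  (Finset.univ.filter fun d : G.D => G.tail d = v ∧ G.head d = w).card

/-! ### Divisors and the sandpile group -/

/-- The total degree homomorphism on divisors. -/
def degHom : (G.V → ℤ) →+ ℤ where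
  toFun x := ∑ v, x v
  map_zero' := by simp
  map_add' x y := by simp [Finset.sum_add_distrib]

/-- Degree-zero divisors. -/
def Div0 : AddSubgroup (G.V → ℤ) := G.degHom.ker

/-- The principal divisor of a lending move at `v`: `v` loses `deg v` chips and
each other vertex `w` gains `n(v,w)` chips. -/
def prin (v : G.V) : G.V → ℤ :=
  fun w => if w = v then -(G.degree v : ℤ) else (G.mul v w : ℤ)

/-- The subgroup of `ℤV` generated by all lending moves. -/
def Prin : AddSubgroup (G.V → ℤ) := AddSubgroup.closure (Set.range G.prin)

/-- Two divisors are linearly equivalent when they differ by a sequence of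
lending moves. -/
def LinEquiv (D D' : G.V → ℤ) : Prop := D' - D ∈ G.Prin

/-- The sandpile group (Jacobian) of `G`: degree-zero divisors modulo
linear equivalence. -/
def Jac := G.Div0 ⧸ (G.Prin.addSubgroupOf G.Div0)

instance : AddCommGroup G.Jac :=
  inferInstanceAs (AddCommGroup (G.Div0 ⧸ (G.Prin.addSubgroupOf G.Div0)))

/-- The divisor class of a degree-zero divisor in the sandpile group. -/
def divClass (D : G.Div0) : G.Jac := QuotientAddGroup.mk D

/-- The divisor `a - b` for vertices `a`, `b`. -/
def unitDivFun (a b : G.V) : G.V → ℤ :=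
  fun w => (if w = a then 1 else 0) - (if w = b then 1 else 0)

lemma unitDivFun_mem (a b : G.V) : G.unitDivFun a b ∈ G.Div0 := by
  simp [Div0, degHom, AddMonoidHom.mem_ker, unitDivFun, Finset.sum_sub_distrib]

/-- The divisor `a - b` as a degree-zero divisor. -/
def unitDiv (a b : G.V) : G.Div0 := ⟨G.unitDivFun a b, G.unitDivFun_mem a b⟩

/-- The class `[a - b] ∈ Jac(G)`. -/
def unitClass (a b : G.V) : G.Jac := G.divClass (G.unitDiv a b)

/-- The boundary of a dart: `∂ d = [d⁺ - d⁻] ∈ Jac(G)`. -/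
def dartBoundary (d : G.D) : G.Jac := G.unitClass (G.head d) (G.tail d)

/-! ### The group ℤE of formal sums of oriented edges -/

/-- `ℤE`: functions on darts that are antisymmetric under reversal;
this is the free abelian group on the oriented edges, with `-e` identified
with the oppositely oriented edge. -/
def EdgeGroup : AddSubgroup (G.D → ℤ) where
  carrier := {x | ∀ d, x (G.rev d) = -x d}
  add_mem' := by
    intro a b ha hb d
    simp only [Pi.add_apply, ha d, hb d]
    ring
  zero_mem' := by intro d; simp
  neg_mem' := by
    intro a ha d
    simp only [Pi.neg_apply, ha d]

/-- The element of `ℤE` corresponding to a single oriented edge (dart). -/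
def dartVec (d : G.D) : G.D → ℤ :=
  fun d' => if d' = d then 1 else if d' = G.rev d then -1 else 0

lemma dartVec_mem (d : G.D) : G.dartVec d ∈ G.EdgeGroup := by
  have hinj := G.rev_invol.injective
  intro d'
  unfold dartVec
  rcases eq_or_ne d' d with rfl | h1
  · simp [G.rev_ne d']
  · rcases eq_or_ne d' (G.rev d) with rfl | h2
    · simp [G.rev_invol d, G.rev_ne d]
    · have h3 : G.rev d' ≠ d := fun h => h2 (by rw [← h, G.rev_invol])
      have h4 : G.rev d' ≠ G.rev d := fun h => h1 (hinj h)
      simp [h1, h2, h3, h4]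

/-- The vector of a list of darts (e.g. of a directed cycle). -/
def listVec (l : List G.D) : G.D → ℤ := (l.map G.dartVec).sum

/-- `l` is a directed cycle: a nonempty closed walk of darts through
pairwise distinct vertices. -/
def IsDirCycle (l : List G.D) : Prop :=
  l ≠ [] ∧ l.Chain' (fun a b => G.head a = G.tail b) ∧
    (∀ a ∈ l.getLast?, ∀ b ∈ l.head?, G.head a = G.tail b) ∧
    (l.map G.tail).Nodup

/-- The integral cycle space `𝒞 ⊆ ℤE`. -/
def CycleSpace : AddSubgroup (G.D → ℤ) :=
  AddSubgroup.closure {x | ∃ l : List G.D, G.IsDirCycle l ∧ x = G.listVec l}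

/-- The cut determined by a set `U` of vertices, directed out of `U`. -/
def cutVec (U : Finset G.V) : G.D → ℤ := fun d =>
  if G.tail d ∈ U ∧ G.head d ∉ U then 1
  else if G.head d ∈ U ∧ G.tail d ∉ U then -1 else 0

/-- The integral cut space `𝒞* ⊆ ℤE`. -/
def CutSpace : AddSubgroup (G.D → ℤ) :=
  AddSubgroup.closure (Set.range G.cutVec)

/-- `ℰ(G) = ℤE / (𝒞 + 𝒞*)`. -/
def EGroup :=
  G.EdgeGroup ⧸ ((G.CycleSpace ⊔ G.CutSpace).addSubgroupOf G.EdgeGroup)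

instance : AddCommGroup G.EGroup :=
  inferInstanceAs
    (AddCommGroup (G.EdgeGroup ⧸ ((G.CycleSpace ⊔ G.CutSpace).addSubgroupOf G.EdgeGroup)))

/-- The class of an oriented edge in `ℰ(G)`. -/
def eClass (d : G.D) : G.EGroup :=
  QuotientAddGroup.mk ⟨G.dartVec d, G.dartVec_mem d⟩

/-- The boundary map `ℤE → ℤV`, sending an oriented edge `e` to `e⁺ - e⁻`
(when restricted to `ℤE ⊆ (D → ℤ)`). -/
def bMap : (G.D → ℤ) →+ (G.V → ℤ) where
  toFun x := fun v => ∑ d ∈ Finset.univ.filter (fun d => G.head d = v), x d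
  map_zero' := by funext v; simp
  map_add' x y := by funext v; simp [Finset.sum_add_distrib]

/-! ### Spanning trees -/

/-- Adjacency using only darts in `T`. -/
def treeAdj (T : Finset G.D) (u v : G.V) : Prop :=
  ∃ d ∈ T, G.tail d = u ∧ G.head d = v

/-- `T` (a reversal-closed set of darts) is a spanning tree: it is connected,
meets every vertex, and has exactly `|V| - 1` edges (hence is acyclic). -/
def IsSpanningTree (T : Finset G.D) : Prop :=
  (∀ d ∈ T, G.rev d ∈ T) ∧
    (∀ u v : G.V, Relation.ReflTransGen (G.treeAdj T) u v) ∧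
    T.card = 2 * (Fintype.card G.V - 1)

/-- The reversal involution as a permutation of darts. -/
def revPerm : Equiv.Perm G.D := Function.Involutive.toPerm G.rev G.rev_invol

end Multigraph

/-- A ribbon graph: a multigraph together with, at each vertex, a cyclic
ordering of the incident edges (darts).  `next d` is the dart following `d`
in the cyclic order at the tail of `d`. -/
structure RibbonGraph extends Multigraph where
  next : Equiv.Perm toMultigraph.D
  next_tail : ∀ d : toMultigraph.D, toMultigraph.tail (next d) = toMultigraph.tail d
  next_cyclic : ∀ d d' : toMultigraph.D,
    toMultigraph.tail d = toMultigraph.tail d' → next.SameCycle d d'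

namespace RibbonGraph

variable (G : RibbonGraph)

/-- The face permutation of a ribbon graph; its orbits are the faces of the
associated surface embedding (the orbit of a dart `d` is the face to the left
of `d`, when the cyclic orders are taken clockwise). -/
def facePerm : Equiv.Perm G.D := G.next * G.revPerm

/-- Darts lie in the same face when they are in the same orbit of the face
permutation. -/
def faceSetoid : Setoid G.D :=
  ⟨G.facePerm.SameCycle,
    ⟨fun x => Equiv.Perm.SameCycle.refl _ x, fun h => h.symm, fun h h' => h.trans h'⟩⟩

/-- The faces of the surface embedding determined by the ribbon structure. -/
def Faces := Quotient G.faceSetoid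

instance : Fintype G.Faces :=
  @Quotient.fintype _ _ G.faceSetoid
    (fun a b => inferInstanceAs (Decidable (G.facePerm.SameCycle a b)))

/-- The face to the left of a dart. -/
def leftFace (d : G.D) : G.Faces := Quotient.mk G.faceSetoid d

/-- The face to the right of a dart. -/
def rightFace (d : G.D) : G.Faces := G.leftFace (G.rev d)

/-- `G` is a planar ribbon graph: the surface it embeds in has genus `0`,
i.e. Euler's formula `|V| - |E| + |F| = 2` holds. -/
def IsPlanar : Prop :=
  Fintype.card G.V + Fintype.card G.Faces = Fintype.card G.D / 2 + 2

/-! ### Rotor-routing -/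

/-- A rotor configuration with basepoint `q`: a choice, for each vertex
`v ≠ q`, of a dart with tail `v`. -/
def RotorConfig (q : G.V) :=
  {ρ : (v : G.V) → v ≠ q → G.D // ∀ (v : G.V) (h : v ≠ q), G.tail (ρ v h) = v}

/-- Firing the vertex `v ≠ q` in a state (chip configuration, rotor
configuration): the rotor at `v` advances to the next dart in the cyclic
order at `v`, and one chip moves from `v` to the head of the new rotor. -/
def fire (q : G.V) (v : G.V) (hv : v ≠ q) (s : (G.V → ℤ) × G.RotorConfig q) :
    (G.V → ℤ) × G.RotorConfig q :=
  ((fun w => s.1 w - (if w = v then 1 else 0) +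
      (if w = G.head (G.next (s.2.1 v hv)) then 1 else 0)),
   ⟨fun u hu => if u = v then G.next (s.2.1 v hv) else s.2.1 u hu, by
      intro u hu
      by_cases h : u = v
      · simp only [if_pos h]
        rw [G.next_tail, s.2.2 v hv, h]
      · simp only [if_neg h]
        exact s.2.2 u hu⟩)

/-- A single legal rotor-routing step: fire some vertex `v ≠ q` carrying at
least one chip. -/
def Step (q : G.V) (s s' : (G.V → ℤ) × G.RotorConfig q) : Prop :=
  ∃ (v : G.V) (hv : v ≠ q), 1 ≤ s.1 v ∧ s' = G.fire q v hv s

/-- A state is terminal when no vertex other than `q` can be fired. -/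
def Terminal (q : G.V) (s : (G.V → ℤ) × G.RotorConfig q) : Prop :=
  ∀ v : G.V, v ≠ q → s.1 v ≤ 0

/-- `ρ` is the rotor configuration obtained by orienting the spanning tree
`T` towards the root `q`: every rotor is a dart of `T`, and following the
rotors from any vertex leads to `q`. -/
def TowardRoot (q : G.V) (T : Finset G.D) (ρ : G.RotorConfig q) : Prop :=
  ∀ (v : G.V) (h : v ≠ q), ρ.1 v h ∈ T ∧
    Relation.ReflTransGen (fun a b => ∃ ha : a ≠ q, G.head (ρ.1 a ha) = b) v q

/-- The rotor-routing process started from a representative of `x` that is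
nonnegative away from `q` and from the rotor configuration of `T` oriented
towards `q` terminates at the rotor configuration of `T'` oriented towards
`q`. -/
def ActsTo (q : G.V) (x : G.Jac) (T T' : Finset G.D) : Prop :=
  ∃ D : G.Div0, G.divClass D = x ∧ (∀ v : G.V, v ≠ q → 0 ≤ (D : G.V → ℤ) v) ∧
    ∃ (ρ ρ' : G.RotorConfig q) (c' : G.V → ℤ),
      G.TowardRoot q T ρ ∧ G.TowardRoot q T' ρ' ∧
      Relation.ReflTransGen (G.Step q) ((D : G.V → ℤ), ρ) (c', ρ') ∧
      G.Terminal q (c', ρ')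

/-- The rotor-routing action of the sandpile group element `x` on the
spanning tree `T`, with basepoint `q`. -/
noncomputable def rotorAction (q : G.V) (x : G.Jac) (T : Finset G.D) :
    Finset G.D :=
  if h : ∃ T' : Finset G.D, G.IsSpanningTree T' ∧ G.ActsTo q x T T' then
    h.choose
  else T

/-! ### Angles -/

/-- The angle `∠ᵘ(d, d')` between two darts with the same tail `u`:
if `d = e₀, e₁, …, e_k = d'` are the consecutive darts in the cyclic order
at `u`, the angle is `∑_{i=1}^{k} ∂ eᵢ ∈ Jac(G)`. -/
noncomputable def dartAngle (d d' : G.D) : G.Jac :=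
  if h : ∃ k : ℕ, (⇑G.next)^[k] d = d' then
    ∑ i ∈ Finset.range (Nat.find h), G.dartBoundary ((⇑G.next)^[i + 1] d)
  else 0

/-- The angle `∠_v(T, T')` between two spanning trees `T, T'` based at `v`:
the sum over all vertices `u ≠ v` of the angles between the rotors of `T`
and of `T'` at `u` (both oriented towards `v`). -/
noncomputable def treeAngle (v : G.V) (T T' : Finset G.D) : G.Jac :=
  if h : ∃ p : G.RotorConfig v × G.RotorConfig v,
      G.TowardRoot v T p.1 ∧ G.TowardRoot v T' p.2 then
    ∑ u : G.V,
      if hu : u = v then 0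
      else G.dartAngle (h.choose.1.1 u hu) (h.choose.2.1 u hu)
  else 0


/-! ### The planar dual ribbon graph -/

/-- The dual ribbon graph `G*` of a ribbon graph `G`: its vertices are the
faces of `G`, its darts are the darts of `G`, where the dart `d`, viewed in
the dual, crosses `d` from the face after `d` (its right, its dual tail) to
the face before `d` (its left, its dual head), and the cyclic orders at the
faces are the counter-clockwise ones. -/
noncomputable def dual : RibbonGraph where
  V := G.Faces
  D := G.D
  fV := inferInstance
  dV := Classical.decEq _
  fD := G.fD
  dD := G.dD
  rev := G.rev
  rev_invol := G.rev_invol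
  rev_ne := G.rev_ne
  head := fun d => G.leftFace d
  next := G.revPerm * G.facePerm * G.revPerm
  next_tail := by
    intro d
    show G.leftFace (G.rev (G.rev (G.facePerm (G.rev d)))) = G.leftFace (G.rev d)
    rw [G.rev_invol]
    exact Quotient.sound ⟨-1, by simp⟩
  next_cyclic := by
    intro d d' h
    have h1 : G.facePerm.SameCycle (G.rev d) (G.rev d') := Quotient.exact h
    have h2 := h1.conj (g := G.revPerm)
    have hR : G.revPerm⁻¹ = G.revPerm := by
      rw [Equiv.Perm.inv_def]
      exact Function.Involutive.toPerm_symm G.rev_invol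
    rw [hR] at h2
    have e1 : G.revPerm (G.rev d) = d := G.rev_invol d
    have e2 : G.revPerm (G.rev d') = d' := G.rev_invol d'
    rw [e1, e2] at h2
    exact h2


end RibbonGraph

namespace Multigraph

variable (G : Multigraph)

lemma tail_rev (d : G.D) : G.tail (G.rev d) = G.head d := by
  simp [tail, G.rev_invol d]

lemma head_rev (d : G.D) : G.head (G.rev d) = G.tail d := rfl

lemma exists_dart_leaving (hconn : G.Connected) (P : Set G.V) {u v : G.V} (hu : u ∈ P)
    (hv : v ∉ P) : ∃ d, G.tail d ∈ P ∧ G.head d ∉ P := by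
  by_contra! h
  refine hv ?_
  clear hv
  induction hconn u v with
  | refl => exact hu
  | tail _ hbc ih =>
    obtain ⟨d, rfl, rfl⟩ := hbc
    exact h d ih

variable {G} in
lemma IsSpanningTree.connected {T : Finset G.D} (hT : G.IsSpanningTree T) : G.Connected :=
  fun u v => (hT.2.1 u v).lift id fun _ _ ⟨d, _, ht, hh⟩ => ⟨d, ht, hh⟩

/-! ### Flows -/

/-- The divisor of a flow that sends `F d` chips along every dart `d`. -/
def flowDiv (F : G.D → ℤ) : G.V → ℤ :=
  fun w => ∑ d, F d * G.unitDivFun (G.head d) (G.tail d) w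

lemma flowDiv_add (F F' : G.D → ℤ) : G.flowDiv (F + F') = G.flowDiv F + G.flowDiv F' := by
  funext w
  simp [flowDiv, add_mul, Finset.sum_add_distrib]

lemma flowDiv_neg (F : G.D → ℤ) : G.flowDiv (-F) = -G.flowDiv F := by
  funext w
  simp [flowDiv]

lemma flowDiv_sub (F F' : G.D → ℤ) : G.flowDiv (F - F') = G.flowDiv F - G.flowDiv F' := by
  rw [sub_eq_add_neg, flowDiv_add, flowDiv_neg, sub_eq_add_neg]

lemma flowDiv_single (e : G.D) :
    G.flowDiv (Pi.single e 1) = G.unitDivFun (G.head e) (G.tail e) := by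
  funext w
  simp [flowDiv, Pi.single_apply]

lemma flowDiv_const (c : ℤ) : G.flowDiv (fun _ => c) = 0 := by
  funext w
  have h : ∑ d, (if w = G.head d then (1 : ℤ) else 0) = ∑ d, if w = G.tail d then (1 : ℤ) else 0 :=
    (Equiv.sum_comp G.revPerm fun d => if w = G.head d then (1 : ℤ) else 0).symm
  simp only [flowDiv, unitDivFun, ← Finset.mul_sum, Finset.sum_sub_distrib, h, sub_self, mul_zero,
    Pi.zero_apply]

/-- A conservative flow that is nonnegative on the darts leaving vertices of `P` and nonpositive on
all other darts vanishes on the darts leaving `P`. -/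
lemma flow_eq_zero_of_leaving {F : G.D → ℤ} (hF : G.flowDiv F = 0) (P : Set G.V)
    (hpos : ∀ d, G.tail d ∈ P → 0 ≤ F d) (hneg : ∀ d, G.tail d ∉ P → F d ≤ 0) (d : G.D)
    (ht : G.tail d ∈ P) (hh : G.head d ∉ P) : F d = 0 := by
  have hsum : ∑ d, F d * ((if G.head d ∈ P then 1 else 0) - if G.tail d ∈ P then 1 else 0) = 0 := by
    have h : ∑ w ∈ Finset.univ.filter (· ∈ P), G.flowDiv F w = 0 := by simp [hF]
    simp only [flowDiv] at h
    rw [Finset.sum_comm] at h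
    refine Eq.trans (Finset.sum_congr rfl fun d _ => ?_) h
    simp [← Finset.mul_sum, unitDivFun, Finset.sum_sub_distrib]
  rw [Finset.sum_eq_zero_iff_of_nonpos] at hsum
  · simpa [ht, hh] using hsum d (Finset.mem_univ d)
  · intro d _
    by_cases h1 : G.tail d ∈ P <;> by_cases h2 : G.head d ∈ P
    · simp [h1, h2]
    · simpa [h1, h2] using hpos d h1
    · simpa [h1, h2] using hneg d h1
    · simp [h1, h2]

/-! ### Principal divisors -/

lemma prin_eq_flowDiv (hloop : G.Loopless) (v : G.V) :
    G.prin v = G.flowDiv fun d => if G.tail d = v then 1 else 0 := by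
  funext w
  unfold prin flowDiv degree mul unitDivFun
  simp only [Finset.card_filter, Nat.cast_sum, ← Finset.sum_neg_distrib]
  split_ifs with hw
  · subst hw
    refine Finset.sum_congr rfl fun d _ => ?_
    have := hloop d
    by_cases h : G.tail d = w
    · subst h
      simp [this.symm]
    · simp [h]
  · refine Finset.sum_congr rfl fun d _ => ?_
    by_cases h : G.tail d = v
    · subst h
      simp [hw, eq_comm]
    · simp [h]

lemma exists_flowDiv_of_mem_Prin (hloop : G.Loopless) (q : G.V) {p : G.V → ℤ} (hp : p ∈ G.Prin) :
    ∃ n : G.V → ℤ, n q = 0 ∧ p = G.flowDiv fun d => n (G.tail d) := by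
  obtain ⟨n, rfl⟩ : ∃ n : G.V → ℤ, p = G.flowDiv fun d => n (G.tail d) := by
    induction hp using AddSubgroup.closure_induction with
    | mem p hp =>
      obtain ⟨v, rfl⟩ := hp
      exact ⟨fun u => if u = v then 1 else 0, G.prin_eq_flowDiv hloop v⟩
    | zero => exact ⟨0, (G.flowDiv_const 0).symm⟩
    | add _ _ _ _ h h' =>
      obtain ⟨n, rfl⟩ := h
      obtain ⟨n', rfl⟩ := h'
      exact ⟨n + n', (G.flowDiv_add _ _).symm⟩
    | neg _ _ h =>
      obtain ⟨n, rfl⟩ := h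
      exact ⟨-n, (G.flowDiv_neg _).symm⟩
  refine ⟨fun v => n v - n q, sub_self _, ?_⟩
  have h := G.flowDiv_sub (fun d => n (G.tail d)) fun _ => n q
  rw [flowDiv_const, sub_zero] at h
  exact h.symm

/-- Every divisor is linearly equivalent to one that is nonnegative away from `q`. -/
lemma exists_add_prin_nonneg (hconn : G.Connected) (q : G.V) (D : G.V → ℤ) :
    ∃ p ∈ G.Prin, ∀ v, v ≠ q → 0 ≤ D v + p v := by
  let good : Finset G.V → Prop := fun U =>
    ∀ D : G.V → ℤ, (∀ v, v ∉ U → 0 ≤ D v) → ∃ p ∈ G.Prin, ∀ v, v ≠ q → 0 ≤ D v + p v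
  have hq : good {q} := fun D hD => ⟨0, zero_mem _, fun v hv => by simpa using hD v (by simpa)⟩
  have hstep : ∀ U, good U → ∀ d, G.tail d ∈ U → G.head d ∉ U → good (insert (G.head d) U) := by
    intro U hU d ht hh D hD
    have hval : ∀ v ∉ U, (∑ u ∈ U, G.prin u) v = ∑ u ∈ U, (G.mul u v : ℤ) := by
      intro v hv
      rw [Finset.sum_apply]
      refine Finset.sum_congr rfl fun u hu => ?_
      simp [prin, show v ≠ u from fun h => hv (h ▸ hu)]
    obtain ⟨p, hp, hpos⟩ := hU (D + |D (G.head d)| • ∑ u ∈ U, G.prin u) (by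
      intro v hv
      have hnn : 0 ≤ (∑ u ∈ U, G.prin u) v := by
        rw [hval v hv]
        positivity
      by_cases hvd : v = G.head d
      · subst hvd
        have h1 : 1 ≤ (∑ u ∈ U, G.prin u) (G.head d) := by
          rw [hval _ hv]
          refine le_trans ?_ (Finset.single_le_sum (f := fun u => (G.mul u (G.head d) : ℤ))
            (fun _ _ => by positivity) ht)
          have : 0 < G.mul (G.tail d) (G.head d) :=
            Finset.card_pos.2 ⟨d, Finset.mem_filter.2 ⟨Finset.mem_univ d, rfl, rfl⟩⟩
          exact_mod_cast this
        have h2 := neg_abs_le (D (G.head d))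
        have h3 := abs_nonneg (D (G.head d))
        simp only [Pi.add_apply, Pi.smul_apply, smul_eq_mul]
        nlinarith
      · have h1 := hD v (by simp [hvd, hv])
        have h3 := abs_nonneg (D (G.head d))
        simp only [Pi.add_apply, Pi.smul_apply, smul_eq_mul]
        positivity)
    refine ⟨|D (G.head d)| • ∑ u ∈ U, G.prin u + p, add_mem (zsmul_mem (sum_mem fun u _ =>
      AddSubgroup.subset_closure (Set.mem_range_self u)) _) hp, fun v hv => ?_⟩
    have := hpos v hv
    simp only [Pi.add_apply] at this ⊢
    linarith
  obtain ⟨U, hU, hmax⟩ := Finset.exists_max_image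
    (Finset.univ.filter fun U : Finset G.V => q ∈ U ∧ good U) Finset.card
    ⟨{q}, Finset.mem_filter.2 ⟨Finset.mem_univ _, Finset.mem_singleton_self q, hq⟩⟩
  obtain ⟨-, hqU, hU⟩ := Finset.mem_filter.1 hU
  refine hU D fun v hv => ?_
  obtain ⟨d, ht, hh⟩ := G.exists_dart_leaving hconn (U : Set G.V) hqU hv
  have := hmax _ (Finset.mem_filter.2
    ⟨Finset.mem_univ _, Finset.mem_insert_of_mem hqU, hstep U hU d ht hh⟩)
  rw [Finset.card_insert_of_notMem hh] at this
  omega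

/-! ### Divisor classes -/

lemma divClass_add (D D' : G.Div0) : G.divClass (D + D') = G.divClass D + G.divClass D' := rfl

lemma divClass_eq_zero_iff (D : G.Div0) : G.divClass D = 0 ↔ (D : G.V → ℤ) ∈ G.Prin :=
  (QuotientAddGroup.eq_zero_iff D).trans AddSubgroup.mem_addSubgroupOf

lemma unitClass_add (a b c : G.V) : G.unitClass a b + G.unitClass b c = G.unitClass a c := by
  rw [unitClass, unitClass, unitClass, ← divClass_add]
  congr 1
  ext w
  simp [unitDiv, unitDivFun]

lemma unitClass_sub (a b c : G.V) : G.unitClass a c - G.unitClass b c = G.unitClass a b := by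
  rw [← G.unitClass_add a b c, add_sub_cancel_right]

lemma exists_divClass_eq_nonneg (hconn : G.Connected) (hloop : G.Loopless) (q : G.V) (x : G.Jac) :
    ∃ D : G.Div0, G.divClass D = x ∧ ∀ v, v ≠ q → 0 ≤ (D : G.V → ℤ) v := by
  obtain ⟨D, rfl⟩ := QuotientAddGroup.mk_surjective x
  obtain ⟨p, hp, hpos⟩ := G.exists_add_prin_nonneg hconn q D
  have hp0 : p ∈ G.Div0 := by
    obtain ⟨n, -, rfl⟩ := G.exists_flowDiv_of_mem_Prin hloop q hp
    refine (AddMonoidHom.mem_ker).2 ?_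
    simp only [degHom, AddMonoidHom.coe_mk, ZeroHom.coe_mk, flowDiv]
    rw [Finset.sum_comm]
    refine Finset.sum_eq_zero fun d _ => ?_
    simp [← Finset.mul_sum, unitDivFun]
  refine ⟨D + ⟨p, hp0⟩, ?_, fun v hv => hpos v hv⟩
  rw [divClass_add, (G.divClass_eq_zero_iff ⟨p, hp0⟩).2 hp, add_zero]
  rfl

/-- A choice of one dart from each edge. -/
lemma exists_orientation : ∃ O : G.D → Prop, ∀ d, O (G.rev d) ↔ ¬ O d := by
  let f := Fintype.equivFin G.D
  refine ⟨fun d => f d < f (G.rev d), fun d => ?_⟩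
  have h : f (G.rev d) ≠ f d := fun h => G.rev_ne d (f.injective h)
  simp only [G.rev_invol d, not_lt]
  exact ⟨le_of_lt, fun h' => lt_of_le_of_ne h' h⟩

lemma even_card_darts : Even (Fintype.card G.D) := by
  obtain ⟨O, hO⟩ := G.exists_orientation
  have h : (Finset.univ.filter O).card = (Finset.univ.filter fun d => ¬ O d).card :=
    Finset.card_bij' (fun d _ => G.rev d) (fun d _ => G.rev d) (by simp [hO]) (by simp [hO])
      (fun d _ => G.rev_invol d) (fun d _ => G.rev_invol d)
  have h' := Finset.card_filter_add_card_filter_not (s := (Finset.univ : Finset G.D)) O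
  rw [← Finset.card_univ, ← h', ← h]
  exact ⟨_, rfl⟩

end Multigraph

namespace RibbonGraph

variable (G : RibbonGraph) {q : G.V}

/-! ### Rotor configurations leading to the basepoint -/

/-- Following the rotors of `ρ` leads from every vertex to `q`. -/
def LeadsToRoot (ρ : G.RotorConfig q) : Prop :=
  ∀ v, Relation.ReflTransGen (fun a b => ∃ ha : a ≠ q, G.head (ρ.1 a ha) = b) v q

lemma leadsToRoot_iff (ρ : G.RotorConfig q) :
    G.LeadsToRoot ρ ↔
      ∀ P : Set G.V, q ∉ P → (∀ a (ha : a ≠ q), a ∈ P → G.head (ρ.1 a ha) ∈ P) → P = ∅ := by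
  constructor
  · intro h P hq hP
    refine Set.eq_empty_of_forall_notMem fun v => ?_
    induction h v using Relation.ReflTransGen.head_induction_on with
    | refl => exact hq
    | head hab _ ih =>
      obtain ⟨ha, rfl⟩ := hab
      exact fun hmem => ih (hP _ ha hmem)
  · intro h v
    by_contra hv
    have := h {v | ¬ Relation.ReflTransGen (fun a b => ∃ ha : a ≠ q, G.head (ρ.1 a ha) = b) v q}
      (fun hq => hq Relation.ReflTransGen.refl) fun a ha hna hh => hna (hh.head ⟨ha, rfl⟩)
    exact (this ▸ hv : v ∈ (∅ : Set G.V))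

/-- The set of darts of the edges of the rotors of `ρ`. -/
def rotorEdges (ρ : G.RotorConfig q) : Finset G.D :=
  Finset.univ.image fun p : {u // u ≠ q} × Bool =>
    bif p.2 then ρ.1 p.1 p.1.2 else G.rev (ρ.1 p.1 p.1.2)

lemma mem_rotorEdges {ρ : G.RotorConfig q} {d : G.D} :
    d ∈ G.rotorEdges ρ ↔ ∃ u hu, d = ρ.1 u hu ∨ d = G.rev (ρ.1 u hu) := by
  simp only [rotorEdges, Finset.mem_image, Finset.mem_univ, true_and, Prod.exists, Bool.exists_bool,
    cond_true, cond_false, Subtype.exists]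
  exact exists_congr fun u => exists_congr fun hu => by
    rw [or_comm, @eq_comm _ d, @eq_comm _ d]

lemma rotorEdges_injective {ρ : G.RotorConfig q} (hρ : G.LeadsToRoot ρ) :
    Function.Injective fun p : {u // u ≠ q} × Bool =>
      bif p.2 then ρ.1 p.1 p.1.2 else G.rev (ρ.1 p.1 p.1.2) := by
  have key : ∀ u hu w hw, ρ.1 u hu ≠ G.rev (ρ.1 w hw) := by
    intro u hu w hw h
    have h1 : G.head (ρ.1 w hw) = u := by rw [← ρ.2 u hu, h, G.tail_rev]
    have h2 : G.head (ρ.1 u hu) = w := by rw [h, G.head_rev, ρ.2 w hw]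
    have := (G.leadsToRoot_iff ρ).1 hρ {u, w} (by simp [hu.symm, hw.symm]) (by
      rintro a ha (rfl | rfl)
      · simp [h2]
      · simp [h1])
    exact (Set.insert_nonempty _ _).ne_empty this
  have inj : ∀ u hu w hw, ρ.1 u hu = ρ.1 w hw → u = w := by
    intro u hu w hw h
    rw [← ρ.2 u hu, ← ρ.2 w hw, h]
  rintro ⟨⟨u, hu⟩, _ | _⟩ ⟨⟨w, hw⟩, _ | _⟩ h <;> dsimp only [cond_true, cond_false] at h
  · obtain rfl := inj u hu w hw (G.rev_invol.injective h)
    rfl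
  · exact absurd h.symm (key _ _ _ _)
  · exact absurd h (key _ _ _ _)
  · obtain rfl := inj u hu w hw h
    rfl

lemma card_rotorEdges {ρ : G.RotorConfig q} (hρ : G.LeadsToRoot ρ) :
    (G.rotorEdges ρ).card = 2 * (Fintype.card G.V - 1) := by
  rw [rotorEdges, Finset.card_image_of_injective _ (G.rotorEdges_injective hρ), Finset.card_univ,
    Fintype.card_prod, Fintype.card_bool, mul_comm]
  congr 1
  exact Set.card_ne_eq q

/-- The sum over the rotors of a function on edges only depends on the set of rotor edges. -/
lemma sum_rotors_eq_sum_rotorEdges {A : Type*} [AddCommGroup A] {ρ : G.RotorConfig q}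
    (hρ : G.LeadsToRoot ρ) {O : G.D → Prop} (hO : ∀ d, O (G.rev d) ↔ ¬ O d) {ψ : G.D → A}
    (hψ : ∀ d, ψ (G.rev d) = ψ d) :
    ∑ u : {u // u ≠ q}, ψ (ρ.1 u u.2) = ∑ d ∈ G.rotorEdges ρ, if O d then ψ d else 0 := by
  rw [rotorEdges, Finset.sum_image fun _ _ _ _ h => G.rotorEdges_injective hρ h,
    Fintype.sum_prod_type]
  refine Finset.sum_congr rfl fun u _ => ?_
  by_cases h : O (ρ.1 u u.2) <;> simp [hO, hψ, h]

lemma isSpanningTree_rotorEdges {ρ : G.RotorConfig q} (hρ : G.LeadsToRoot ρ) :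
    G.IsSpanningTree (G.rotorEdges ρ) := by
  have hrev : ∀ d ∈ G.rotorEdges ρ, G.rev d ∈ G.rotorEdges ρ := by
    intro d hd
    obtain ⟨u, hu, rfl | rfl⟩ := G.mem_rotorEdges.1 hd
    · exact G.mem_rotorEdges.2 ⟨u, hu, Or.inr rfl⟩
    · exact G.mem_rotorEdges.2 ⟨u, hu, Or.inl (G.rev_invol _)⟩
  have hto : ∀ v, Relation.ReflTransGen (G.treeAdj (G.rotorEdges ρ)) v q := fun v =>
    (hρ v).lift id fun a _ ⟨ha, hb⟩ =>
      ⟨ρ.1 a ha, G.mem_rotorEdges.2 ⟨a, ha, Or.inl rfl⟩, ρ.2 a ha, hb⟩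
  have hsymm : Std.Symm (G.treeAdj (G.rotorEdges ρ)) := ⟨by
    rintro _ _ ⟨d, hd, rfl, rfl⟩
    exact ⟨G.rev d, hrev d hd, G.tail_rev d, rfl⟩⟩
  exact ⟨hrev, fun u v => (hto u).trans (Relation.ReflTransGen.stdSymm.symm _ _ (hto v)),
    G.card_rotorEdges hρ⟩

lemma TowardRoot.leadsToRoot {T : Finset G.D} {ρ : G.RotorConfig q} (h : G.TowardRoot q T ρ) :
    G.LeadsToRoot ρ := by
  intro v
  by_cases hv : v = q
  · rw [hv]
  · exact (h v hv).2

lemma TowardRoot.rotorEdges_eq {T : Finset G.D} (hT : G.IsSpanningTree T) {ρ : G.RotorConfig q}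
    (h : G.TowardRoot q T ρ) : G.rotorEdges ρ = T := by
  refine Finset.eq_of_subset_of_card_le (fun d hd => ?_) ?_
  · obtain ⟨u, hu, rfl | rfl⟩ := G.mem_rotorEdges.1 hd
    · exact (h u hu).1
    · exact hT.1 _ (h u hu).1
  · rw [hT.2.2, G.card_rotorEdges (h.leadsToRoot)]

lemma towardRoot_rotorEdges {ρ : G.RotorConfig q} (hρ : G.LeadsToRoot ρ) :
    G.TowardRoot q (G.rotorEdges ρ) ρ :=
  fun v hv => ⟨G.mem_rotorEdges.2 ⟨v, hv, Or.inl rfl⟩, hρ v⟩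

/-- A spanning tree can be oriented towards `q`, with a rank decreasing along the rotors. -/
lemma exists_towardRoot {T : Finset G.D} (hT : G.IsSpanningTree T) (q : G.V) :
    ∃ (ρ : G.RotorConfig q) (rk : G.V → ℕ), G.TowardRoot q T ρ ∧
      ∀ v hv, rk (G.head (ρ.1 v hv)) < rk v := by
  let R : ℕ → G.V → Prop := fun n => Nat.rec (fun v => v = q)
    (fun _ R v => ∃ d ∈ T, G.tail d = v ∧ R (G.head d)) n
  have hR : ∀ v, ∃ n, R n v := by
    intro v
    induction hT.2.1 v q using Relation.ReflTransGen.head_induction_on with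
    | refl => exact ⟨0, rfl⟩
    | head hab _ ih =>
      obtain ⟨d, hd, rfl, rfl⟩ := hab
      obtain ⟨n, hn⟩ := ih
      exact ⟨n + 1, d, hd, rfl, hn⟩
  let rk : G.V → ℕ := fun v => @Nat.find (fun n => R n v) (Classical.decPred _) (hR v)
  have hrk : ∀ v, v ≠ q → ∃ d ∈ T, G.tail d = v ∧ rk (G.head d) < rk v := by
    intro v hv
    have hspec : R (rk v) v := @Nat.find_spec (fun n => R n v) (Classical.decPred _) (hR v)
    rcases hn : rk v with _ | n
    · rw [hn] at hspec
      exact absurd hspec hv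
    · rw [hn] at hspec
      obtain ⟨d, hd, ht, hn'⟩ := hspec
      exact ⟨d, hd, ht, Nat.lt_succ_of_le
        (@Nat.find_min' (fun n => R n _) (Classical.decPred _) (hR _) n hn')⟩
  choose f hfT hft hfrk using hrk
  refine ⟨⟨f, hft⟩, rk, fun v hv => ⟨hfT v hv, ?_⟩, hfrk⟩
  refine (G.leadsToRoot_iff ⟨f, hft⟩).2 (fun P hqP hP => ?_) v
  by_contra hne
  obtain ⟨a, haP, hmin⟩ := Set.exists_min_image P rk (Set.toFinite P)
    (Set.nonempty_iff_ne_empty.2 hne)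
  have ha : a ≠ q := fun h => hqP (h ▸ haP)
  exact absurd (hmin _ (hP a ha haP)) (not_le.2 (hfrk a ha))

/-! ### Rotor-routing runs -/

variable {G}

lemma Step.exists_eq {s s' : (G.V → ℤ) × G.RotorConfig q} (h : G.Step q s s') :
    ∃ (v : G.V) (hv : v ≠ q), 1 ≤ s.1 v ∧
      s'.1 = s.1 + G.flowDiv (Pi.single (G.next (s.2.1 v hv)) 1) ∧
      ∀ u hu, s'.2.1 u hu = if u = v then G.next (s.2.1 v hv) else s.2.1 u hu := by
  obtain ⟨v, hv, h1, rfl⟩ := h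
  refine ⟨v, hv, h1, ?_, fun u hu => rfl⟩
  rw [Multigraph.flowDiv_single]
  funext w
  simp only [fire, Pi.add_apply, Multigraph.unitDivFun, G.next_tail, s.2.2 v hv]
  ring

lemma Step.nonneg {s s' : (G.V → ℤ) × G.RotorConfig q} (h : G.Step q s s')
    (hs : ∀ v, v ≠ q → 0 ≤ s.1 v) (v : G.V) (hv : v ≠ q) : 0 ≤ s'.1 v := by
  obtain ⟨u, hu, h1, rfl⟩ := h
  have := hs v hv
  simp only [fire]
  split_ifs with h2 h3 h3
  all_goals first | (subst h2; omega) | omega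

lemma Step.le_root {s s' : (G.V → ℤ) × G.RotorConfig q} (h : G.Step q s s') :
    s.1 q ≤ s'.1 q := by
  obtain ⟨u, hu, -, rfl⟩ := h
  simp only [fire, if_neg hu.symm]
  split_ifs <;> omega

lemma Step.mem_Div0 {s s' : (G.V → ℤ) × G.RotorConfig q} (h : G.Step q s s')
    (hs : s.1 ∈ G.Div0) : s'.1 ∈ G.Div0 := by
  obtain ⟨v, hv, -, h', -⟩ := h.exists_eq
  rw [h', Multigraph.flowDiv_single]
  exact add_mem hs (G.unitDivFun_mem _ _)

/-- If a homomorphism `χ` turns the boundary of every dart into a difference of a dart function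
along the cyclic orders, then rotor-routing preserves the sum of `χ` of the chips and of the dart
function over the rotors. -/
lemma run_invariant {A : Type*} [AddCommGroup A] (χ : G.Jac →+ A) (h : G.D → A)
    (hχ : ∀ d, χ (G.dartBoundary (G.next d)) = h d - h (G.next d))
    {s s' : (G.V → ℤ) × G.RotorConfig q} (hrun : Relation.ReflTransGen (G.Step q) s s')
    (hs : s.1 ∈ G.Div0) :
    ∃ hs' : s'.1 ∈ G.Div0,
      χ (G.divClass ⟨s'.1, hs'⟩) + ∑ u : {u // u ≠ q}, h (s'.2.1 u u.2) =
        χ (G.divClass ⟨s.1, hs⟩) + ∑ u : {u // u ≠ q}, h (s.2.1 u u.2) := by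
  induction hrun with
  | refl => exact ⟨hs, rfl⟩
  | @tail a b _ hstep ih =>
    obtain ⟨ha, ih⟩ := ih
    refine ⟨hstep.mem_Div0 ha, ?_⟩
    rw [← ih]
    obtain ⟨v, hv, -, h1, h2⟩ := hstep.exists_eq
    set e := a.2.1 v hv
    have hclass : G.divClass ⟨b.1, hstep.mem_Div0 ha⟩ =
        G.divClass ⟨a.1, ha⟩ + G.dartBoundary (G.next e) := by
      rw [Multigraph.dartBoundary, Multigraph.unitClass, ← Multigraph.divClass_add]
      congr 1
      ext1
      simp only [h1, Multigraph.flowDiv_single]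
      rfl
    have hsum : ∑ u : {u // u ≠ q}, h (b.2.1 u u.2) - ∑ u : {u // u ≠ q}, h (a.2.1 u u.2) =
        h (G.next e) - h e := by
      rw [← Finset.sum_sub_distrib, Finset.sum_eq_single ⟨v, hv⟩]
      · simp [h2, e]
      · intro u _ hu
        have : (u : G.V) ≠ v := fun h => hu (Subtype.ext h)
        simp [h2, this]
      · simp
    rw [hclass, map_add, hχ, ← sub_eq_zero]
    rw [← sub_eq_zero] at hsum
    rw [← hsum]
    abel

/-- The rotor-routing relation in terms of the sums of a dart function over the rotors. -/
lemma ActsTo.exists_rotors {A : Type*} [AddCommGroup A] (χ : G.Jac →+ A) (h : G.D → A)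
    (hχ : ∀ d, χ (G.dartBoundary (G.next d)) = h d - h (G.next d))
    {x : G.Jac} {T T' : Finset G.D} (hact : G.ActsTo q x T T') :
    ∃ ρ ρ' : G.RotorConfig q, G.TowardRoot q T ρ ∧ G.TowardRoot q T' ρ' ∧
      ∑ u : {u // u ≠ q}, h (ρ'.1 u u.2) = χ x + ∑ u : {u // u ≠ q}, h (ρ.1 u u.2) := by
  obtain ⟨D, rfl, hD, ρ, ρ', c', hρ, hρ', hrun, hterm⟩ := hact
  refine ⟨ρ, ρ', hρ, hρ', ?_⟩
  obtain ⟨hc', hinv⟩ := run_invariant χ h hχ hrun D.2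
  have hnn : ∀ v, v ≠ q → 0 ≤ c' v := by
    suffices ∀ s : (G.V → ℤ) × G.RotorConfig q,
        Relation.ReflTransGen (G.Step q) ((D : G.V → ℤ), ρ) s → ∀ v, v ≠ q → 0 ≤ s.1 v from
      this _ hrun
    intro s hs
    induction hs with
    | refl => exact hD
    | tail _ hstep ih => exact hstep.nonneg ih
  have hoff : ∀ v, v ≠ q → c' v = 0 := fun v hv => le_antisymm (hterm v hv) (hnn v hv)
  have hsum : ∑ v, c' v = 0 := hc'
  have hzero : (⟨c', hc'⟩ : G.Div0) = 0 := by
    ext v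
    by_cases hv : v = q
    · rw [Finset.sum_eq_single q (fun v _ hv => hoff v hv) (by simp)] at hsum
      rw [hv]
      exact hsum
    · exact hoff v hv
  simp only [hzero] at hinv
  rw [(G.divClass_eq_zero_iff 0).2 (zero_mem _), map_zero, zero_add] at hinv
  exact hinv

/-- The dart counts of a run of rotor-routing. -/
lemma exists_flow_of_run {s s' : (G.V → ℤ) × G.RotorConfig q}
    (hrun : Relation.TransGen (G.Step q) s s') :
    ∃ F : G.D → ℤ, (∀ d, 0 ≤ F d) ∧ (∃ d, 0 < F d) ∧ (∀ d, G.tail d = q → F d = 0) ∧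
      s'.1 = s.1 + G.flowDiv F ∧
      ∀ d (hd : G.tail d ≠ q), F d + (if s.2.1 _ hd = d then 1 else 0) =
        F (G.next d) + if s'.2.1 _ hd = d then 1 else 0 := by
  have hrot : ∀ {a b : (G.V → ℤ) × G.RotorConfig q} (v : G.V) (hv : v ≠ q),
      (∀ u hu, b.2.1 u hu = if u = v then G.next (a.2.1 v hv) else a.2.1 u hu) →
      ∀ d (hd : G.tail d ≠ q),
        (Pi.single (G.next (a.2.1 v hv)) 1 : G.D → ℤ) d + (if a.2.1 _ hd = d then 1 else 0) =
          (Pi.single (G.next (a.2.1 v hv)) 1 : G.D → ℤ) (G.next d) +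
            if b.2.1 _ hd = d then 1 else 0 := by
    intro a b v hv h d hd
    rw [h]
    simp only [Pi.single_apply, G.next.injective.eq_iff]
    by_cases hdv : G.tail d = v
    · subst hdv
      simp only [if_true, @eq_comm _ d]
      ring
    · have h1 : d ≠ G.next (a.2.1 v hv) := fun h' => hdv (by rw [h', G.next_tail, a.2.2])
      have h2 : d ≠ a.2.1 v hv := fun h' => hdv (by rw [h', a.2.2])
      simp [h1, h2, hdv]
  induction hrun with
  | single hstep =>
    obtain ⟨v, hv, -, h1, h2⟩ := hstep.exists_eq
    refine ⟨_, fun d => ?_, ⟨G.next (s.2.1 v hv), ?_⟩, fun d hd => ?_, h1, hrot v hv h2⟩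
    · simp only [Pi.single_apply]
      split_ifs <;> simp
    · rw [Pi.single_eq_same]
      exact one_pos
    · refine Pi.single_eq_of_ne (fun h => hv ?_) _
      rw [← hd, h, G.next_tail, s.2.2]
  | @tail a b _ hstep ih =>
    obtain ⟨F, hF, ⟨d₀, hd₀⟩, hFq, hFc, hFr⟩ := ih
    obtain ⟨v, hv, -, h1, h2⟩ := hstep.exists_eq
    have hnn : ∀ d, (0 : ℤ) ≤ (Pi.single (G.next (a.2.1 v hv)) 1 : G.D → ℤ) d := by
      intro d
      simp only [Pi.single_apply]
      split_ifs <;> simp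
    refine ⟨F + Pi.single (G.next (a.2.1 v hv)) 1, fun d => add_nonneg (hF d) (hnn d),
      ⟨d₀, add_pos_of_pos_of_nonneg hd₀ (hnn d₀)⟩, fun d hd => ?_, ?_, fun d hd => ?_⟩
    · rw [Pi.add_apply, hFq d hd, zero_add]
      refine Pi.single_eq_of_ne (fun h => hv ?_) _
      rw [← hd, h, G.next_tail, a.2.2]
    · rw [h1, hFc, Multigraph.flowDiv_add, add_assoc]
    · have := hFr d hd
      have := hrot v hv h2 d hd
      simp only [Pi.add_apply]
      linarith

lemma eq_of_tail_eq {A : Type*} (F : G.D → A) (hF : ∀ d, F (G.next d) = F d) {d d' : G.D}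
    (h : G.tail d = G.tail d') : F d = F d' := by
  obtain ⟨i, rfl⟩ := (G.next_cyclic d d' h).exists_nat_pow_eq
  clear h
  induction i with
  | zero => rfl
  | succ i ih => rw [pow_succ', Equiv.Perm.mul_apply, hF, ih]

lemma not_transGen_self (hconn : G.Connected) (s : (G.V → ℤ) × G.RotorConfig q) :
    ¬ Relation.TransGen (G.Step q) s s := by
  intro hrun
  obtain ⟨F, hF, ⟨d₀, hd₀⟩, hFq, hFc, hFr⟩ := exists_flow_of_run hrun
  have hcons : G.flowDiv F = 0 := left_eq_add.1 hFc
  have hnext : ∀ d, F (G.next d) = F d := by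
    intro d
    by_cases hd : G.tail d = q
    · rw [hFq d hd, hFq _ ((G.next_tail d).trans hd)]
    · exact (add_right_cancel (hFr d hd)).symm
  let P : Set G.V := {v | ∃ d, G.tail d = v ∧ 0 < F d}
  have hpos : ∀ d, G.tail d ∈ P → 0 < F d := by
    rintro d ⟨d', hd', hpos⟩
    rwa [eq_of_tail_eq F hnext hd'.symm]
  obtain ⟨d, ht, hh⟩ := G.exists_dart_leaving hconn P (u := G.tail d₀) (v := q) ⟨d₀, rfl, hd₀⟩
    (by rintro ⟨d, hd, hpos⟩; exact hpos.ne' (hFq d hd))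
  refine (hpos d ht).ne' (G.flow_eq_zero_of_leaving hcons P (fun d _ => hF d) (fun d hd => ?_) d
    ht hh)
  exact not_lt.1 fun h => hd ⟨d, rfl, h⟩

lemma exists_terminal (hconn : G.Connected) (s : (G.V → ℤ) × G.RotorConfig q)
    (hs : s.1 ∈ G.Div0) (hnn : ∀ v, v ≠ q → 0 ≤ s.1 v) :
    ∃ s', Relation.ReflTransGen (G.Step q) s s' ∧ G.Terminal q s' := by
  let Ω : Set ((G.V → ℤ) × G.RotorConfig q) :=
    {s' | s'.1 ∈ G.Div0 ∧ (∀ v, v ≠ q → 0 ≤ s'.1 v) ∧ s.1 q ≤ s'.1 q}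
  have hbound : ∀ s' ∈ Ω, s'.1 ∈ Set.Icc (fun _ => -|s.1 q|) (fun _ => |s.1 q|) := by
    rintro s' ⟨h0, hnn', hq⟩
    have hsum : s'.1 q + ∑ v ∈ Finset.univ.erase q, s'.1 v = 0 :=
      (Finset.add_sum_erase _ _ (Finset.mem_univ q)).trans h0
    have hsum_nn : 0 ≤ ∑ v ∈ Finset.univ.erase q, s'.1 v :=
      Finset.sum_nonneg fun v hv => hnn' v (Finset.ne_of_mem_erase hv)
    have h1 := neg_abs_le (s.1 q)
    have h2 := abs_nonneg (s.1 q)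
    refine ⟨fun v => ?_, fun v => ?_⟩ <;> by_cases hv : v = q
    · subst hv
      linarith
    · have := hnn' v hv
      dsimp only
      linarith
    · subst hv
      dsimp only
      linarith
    · have := Finset.single_le_sum (fun v hv => hnn' v (Finset.ne_of_mem_erase hv))
        (Finset.mem_erase.2 ⟨hv, Finset.mem_univ v⟩)
      dsimp only
      linarith
  have : Finite (G.RotorConfig q) := Subtype.finite
  have hfin : Ω.Finite :=
    ((Set.finite_Icc _ _).prod (Set.finite_univ (α := G.RotorConfig q))).subset
      fun s' hs' => ⟨hbound s' hs', Set.mem_univ _⟩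
  have : Finite Ω := hfin
  have hΩ : ∀ s', Relation.ReflTransGen (G.Step q) s s' → s' ∈ Ω := by
    intro s' hrun
    induction hrun with
    | refl => exact ⟨hs, hnn, le_rfl⟩
    | tail _ hstep ih =>
      exact ⟨hstep.mem_Div0 ih.1, hstep.nonneg ih.2.1, ih.2.2.trans hstep.le_root⟩
  let r : Ω → Ω → Prop := fun a b => Relation.TransGen (G.Step q) b.1 a.1
  have : IsTrans Ω r := ⟨fun _ _ _ h h' => h'.trans h⟩
  have : Std.Irrefl r := ⟨fun a => not_transGen_self hconn a.1⟩
  obtain ⟨⟨a, haΩ⟩, ha, hmin⟩ := (Finite.wellFounded_of_trans_of_irrefl r).has_min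
    {a | Relation.ReflTransGen (G.Step q) s a.1} ⟨⟨s, hΩ s .refl⟩, .refl⟩
  refine ⟨a, ha, fun v hv => not_lt.1 fun hlt => ?_⟩
  have hstep : G.Step q a (G.fire q v hv a) := ⟨v, hv, hlt, rfl⟩
  have ha' := Relation.ReflTransGen.tail ha hstep
  exact hmin ⟨_, hΩ _ ha'⟩ ha' (Relation.TransGen.single hstep)

lemma leadsToRoot_of_run {s s' : (G.V → ℤ) × G.RotorConfig q}
    (hrun : Relation.ReflTransGen (G.Step q) s s') (hnn : ∀ v, v ≠ q → 0 ≤ s.1 v)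
    (hs : G.LeadsToRoot s.2) (hterm : G.Terminal q s') : G.LeadsToRoot s'.2 := by
  have key : (∀ v, v ≠ q → 0 ≤ s'.1 v) ∧ ∀ P : Set G.V, q ∉ P →
      (∀ a (ha : a ≠ q), a ∈ P → G.head (s'.2.1 a ha) ∈ P) → P.Nonempty → ∃ v ∈ P, 1 ≤ s'.1 v := by
    clear hterm
    induction hrun with
    | refl => exact ⟨hnn, fun P hq hP hne => absurd ((G.leadsToRoot_iff _).1 hs P hq hP) hne.ne_empty⟩
    | @tail a b _ hstep ih =>
      refine ⟨hstep.nonneg ih.1, fun P hq hP hne => ?_⟩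
      obtain ⟨v, hv, h1, rfl⟩ := hstep
      have hle : ∀ w, w ≠ v → a.1 w ≤ (G.fire q v hv a).1 w := by
        intro w hw
        simp only [fire, if_neg hw]
        split_ifs <;> omega
      by_cases hvP : v ∈ P
      · have hmem := hP v hv hvP
        simp only [fire, if_true] at hmem
        refine ⟨_, hmem, ?_⟩
        have hnn' := ih.1 _ (fun h => hq (h ▸ hmem))
        simp only [fire, if_true]
        split_ifs with h
        · rw [h] at hnn' ⊢
          omega
        · omega
      · obtain ⟨w, hw, hw1⟩ := ih.2 P hq (fun u hu huP => by
          have := hP u hu huP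
          simp only [fire, if_neg (show u ≠ v from fun h => hvP (h ▸ huP))] at this
          exact this) hne
        exact ⟨w, hw, hw1.trans (hle w fun h => hvP (h ▸ hw))⟩
  refine (G.leadsToRoot_iff _).2 fun P hq hP => Set.not_nonempty_iff_eq_empty.1 fun hne => ?_
  obtain ⟨v, hv, h1⟩ := key.2 P hq hP hne
  have := hterm v fun h => hq (h ▸ hv)
  omega

lemma exists_actsTo (hconn : G.Connected) (hloop : G.Loopless) (q : G.V) (x : G.Jac)
    {T : Finset G.D} (hT : G.IsSpanningTree T) :
    ∃ T', G.IsSpanningTree T' ∧ G.ActsTo q x T T' := by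
  obtain ⟨D, hDx, hD⟩ := G.exists_divClass_eq_nonneg hconn hloop q x
  obtain ⟨ρ, -, hρ, -⟩ := G.exists_towardRoot hT q
  obtain ⟨⟨c', ρ'⟩, hrun, hterm⟩ := exists_terminal hconn ((D : G.V → ℤ), ρ) D.2 hD
  have hρ' := leadsToRoot_of_run hrun hD hρ.leadsToRoot hterm
  exact ⟨G.rotorEdges ρ', G.isSpanningTree_rotorEdges hρ', D, hDx, hD, ρ, ρ', c', hρ,
    G.towardRoot_rotorEdges hρ', hrun, hterm⟩

lemma rotorAction_spec (hconn : G.Connected) (hloop : G.Loopless) (q : G.V) (x : G.Jac)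
    {T : Finset G.D} (hT : G.IsSpanningTree T) :
    G.IsSpanningTree (G.rotorAction q x T) ∧ G.ActsTo q x T (G.rotorAction q x T) := by
  have h := exists_actsTo hconn hloop q x hT
  rw [rotorAction, dif_pos h]
  exact h.choose_spec

/-! ### Uniqueness of rotor-routing -/

/-- The darts strictly after `d` and up to `d'` in the cyclic order. -/
lemma exists_arc {h : G.D → G.Jac}
    (hh : ∀ d, G.dartBoundary (G.next d) = h d - h (G.next d)) {d d' : G.D}
    (hd : G.tail d = G.tail d') :
    ∃ S : Finset G.D, (∀ e ∈ S, G.tail e = G.tail d) ∧ (d = d' ∧ S = ∅ ∨ d ∉ S ∧ d' ∈ S) ∧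
      ∑ e ∈ S, G.dartBoundary e = h d - h d' := by
  have hex := (G.next_cyclic d d' hd).exists_nat_pow_eq
  obtain ⟨k, rfl, hmin⟩ : ∃ k, (G.next ^ k) d = d' ∧ ∀ i < k, (G.next ^ i) d ≠ d' :=
    ⟨Nat.find hex, Nat.find_spec hex, fun i hi => Nat.find_min hex hi⟩
  have hne : ∀ m, 0 < m → m ≤ k → (G.next ^ m) d ≠ d := by
    intro m hm hmk heq
    refine hmin (k - m) (by omega) ?_
    conv_lhs => rw [← heq]
    rw [← Equiv.Perm.mul_apply, ← pow_add, Nat.sub_add_cancel hmk]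
  have htail : ∀ i, G.tail ((G.next ^ i) d) = G.tail d := by
    intro i
    induction i with
    | zero => rfl
    | succ i ih => rw [pow_succ', Equiv.Perm.mul_apply, G.next_tail, ih]
  have hlt : ∀ i j, i < j → j < k → (G.next ^ (i + 1)) d ≠ (G.next ^ (j + 1)) d := by
    intro i j hij hjk heq
    refine hne (j - i) (by omega) (by omega) ((G.next ^ (i + 1)).injective ?_)
    rw [← Equiv.Perm.mul_apply, ← pow_add, heq]
    congr 2
    omega
  refine ⟨(Finset.range k).image fun i => (G.next ^ (i + 1)) d, ?_, ?_, ?_⟩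
  · simp only [Finset.mem_image]
    rintro _ ⟨i, -, rfl⟩
    exact htail _
  · rcases Nat.eq_zero_or_pos k with rfl | hk
    · exact Or.inl ⟨rfl, rfl⟩
    · refine Or.inr ⟨?_, Finset.mem_image.2 ⟨k - 1, Finset.mem_range.2 (by omega), ?_⟩⟩
      · simp only [Finset.mem_image, Finset.mem_range, not_exists, not_and]
        exact fun i hi => hne _ (by omega) (by omega)
      · rw [Nat.sub_add_cancel hk]
  · rw [Finset.sum_image]
    · refine Eq.trans (Finset.sum_congr rfl fun i _ => ?_)
        (Finset.sum_range_sub' (fun i => h ((G.next ^ i) d)) k)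
      rw [pow_succ', Equiv.Perm.mul_apply, hh]
    · intro i hi j hj heq
      have hi' : i < k := by simpa using hi
      have hj' : j < k := by simpa using hj
      rcases lt_trichotomy i j with hij | hij | hij
      · exact absurd heq (hlt i j hij hj')
      · exact hij
      · exact absurd heq.symm (hlt j i hij hi')

/-- Two rotor configurations leading to `q` that differ by a trivial total angle are equal. -/
lemma rotors_eq_of_sum_eq (hloop : G.Loopless) {h : G.D → G.Jac}
    (hh : ∀ d, G.dartBoundary (G.next d) = h d - h (G.next d)) {ρ ρ' : G.RotorConfig q}
    (hρ : G.LeadsToRoot ρ) (hρ' : G.LeadsToRoot ρ')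
    (hsum : ∑ u : {u // u ≠ q}, h (ρ.1 u u.2) = ∑ u : {u // u ≠ q}, h (ρ'.1 u u.2)) : ρ = ρ' := by
  choose S hStail hScases hSsum using fun u : {u // u ≠ q} =>
    exists_arc hh ((ρ.2 u u.2).trans (ρ'.2 u u.2).symm)
  have hmemS : ∀ d u, d ∈ S u → G.tail d = u := fun d u hd => (hStail u d hd).trans (ρ.2 u u.2)
  let F₀ : G.D → ℤ := fun d => if ∃ u, d ∈ S u then 1 else 0
  have hF₀S : ∀ d (hd : G.tail d ≠ q), F₀ d = if d ∈ S ⟨_, hd⟩ then 1 else 0 := by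
    intro d hd
    refine if_congr ⟨?_, fun h => ⟨_, h⟩⟩ rfl rfl
    rintro ⟨u, hu⟩
    have : u = ⟨G.tail d, hd⟩ := Subtype.ext (hmemS d u hu).symm
    rwa [← this]
  have hF₀q : ∀ d, G.tail d = q → F₀ d = 0 := by
    intro d hd
    refine if_neg ?_
    rintro ⟨u, hu⟩
    exact u.2 ((hmemS d u hu).symm.trans hd)
  have hF₀_nonneg : ∀ d, 0 ≤ F₀ d := fun d => by simp only [F₀]; split_ifs <;> simp
  have hF₀_le : ∀ d, F₀ d ≤ 1 := fun d => by simp only [F₀]; split_ifs <;> simp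
  have hclass : G.flowDiv F₀ ∈ G.Prin := by
    have hflow : G.flowDiv F₀ = ((∑ u, ∑ e ∈ S u, G.unitDiv (G.head e) (G.tail e) : G.Div0) :
        G.V → ℤ) := by
      have hdisj : Set.PairwiseDisjoint (Finset.univ : Finset {u // u ≠ q}) S := by
        intro u _ v _ huv
        refine Finset.disjoint_left.2 fun d hu hv => huv (Subtype.ext ?_)
        rw [← hmemS d u hu, ← hmemS d v hv]
      rw [← Finset.sum_biUnion hdisj, AddSubgroup.val_finsetSum]
      funext w
      simp only [Multigraph.flowDiv, F₀, ite_mul, one_mul, zero_mul, Finset.sum_apply,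
        ← Finset.sum_filter]
      refine Finset.sum_congr ?_ fun _ _ => rfl
      ext d
      simp
    rw [hflow, ← G.divClass_eq_zero_iff]
    have hmap : ∀ D, G.divClass D = QuotientAddGroup.mk' (G.Prin.addSubgroupOf G.Div0) D :=
      fun _ => rfl
    have : ∑ u, ∑ e ∈ S u, G.dartBoundary e = 0 := by
      simp only [hSsum, Finset.sum_sub_distrib, hsum, sub_self]
    rw [← this, hmap, map_sum]
    refine Finset.sum_congr rfl fun u _ => ?_
    rw [map_sum]
    rfl
  obtain ⟨n, hnq, hn⟩ := G.exists_flowDiv_of_mem_Prin hloop q hclass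
  let F : G.D → ℤ := F₀ - fun d => n (G.tail d)
  have hF : G.flowDiv F = 0 := by rw [Multigraph.flowDiv_sub, ← hn, sub_self]
  have hFq : ∀ d, G.tail d = q → F d = 0 := by
    intro d hd
    simp [F, hF₀q d hd, hd, hnq]
  have hFdef : ∀ d, F d = F₀ d - n (G.tail d) := fun _ => rfl
  have hnle : ∀ u (hu : u ≠ q), n u ≤ 0 := by
    intro u hu
    by_contra hlt
    have hempty := (G.leadsToRoot_iff ρ).1 hρ {u | u ≠ q ∧ 0 < n u} (fun h => h.1 rfl) (by
      rintro a ha ⟨-, hna⟩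
      by_contra hhead
      have hzero := G.flow_eq_zero_of_leaving (F := -F)
        (by rw [Multigraph.flowDiv_neg, hF, neg_zero]) {u | u ≠ q ∧ 0 < n u}
        (fun d hd => by
          have := hF₀_le d
          have := hd.2
          simp only [Pi.neg_apply, hFdef]
          omega)
        (fun d hd => by
          by_cases hdq : G.tail d = q
          · simp [hFq d hdq]
          · have := hF₀_nonneg d
            have : ¬ 0 < n (G.tail d) := fun h => hd ⟨hdq, h⟩
            simp only [Pi.neg_apply, hFdef]
            omega)
        (ρ.1 a ha) (by rw [ρ.2 a ha]; exact ⟨ha, hna⟩) hhead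
      have h0 : F₀ (ρ.1 a ha) = 0 := by
        refine if_neg ?_
        rintro ⟨u, hu⟩
        obtain rfl : a = u := by rw [← ρ.2 a ha, hmemS _ u hu]
        rcases hScases u with ⟨-, h⟩ | ⟨h, -⟩
        · rw [h] at hu
          simp at hu
        · exact h hu
      simp only [Pi.neg_apply, hFdef, h0, ρ.2 a ha] at hzero
      omega)
    exact (hempty ▸ (show u ∈ {u | u ≠ q ∧ 0 < n u} from ⟨hu, not_le.1 hlt⟩) : u ∈ (∅ : Set G.V))
  have hF_nonneg : ∀ d, 0 ≤ F d := by
    intro d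
    by_cases hdq : G.tail d = q
    · rw [hFq d hdq]
    · have := hF₀_nonneg d
      have := hnle _ hdq
      rw [hFdef]
      omega
  have hempty := (G.leadsToRoot_iff ρ').1 hρ'
    {u | ∃ hu : u ≠ q, ρ.1 u hu ≠ ρ'.1 u hu ∨ n u < 0} (fun h => h.1 rfl) (by
      rintro a ha ⟨_, hna⟩
      by_contra hhead
      have hzero := G.flow_eq_zero_of_leaving hF
        {u | ∃ hu : u ≠ q, ρ.1 u hu ≠ ρ'.1 u hu ∨ n u < 0} (fun d _ => hF_nonneg d)
        (fun d hd => by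
          by_cases hdq : G.tail d = q
          · rw [hFq d hdq]
          · simp only [Set.mem_ofPred_eq, not_exists, not_or, not_not, not_lt] at hd
            obtain ⟨h1, h2⟩ := hd hdq
            have hS : F₀ d = 0 := by
              rw [hF₀S d hdq]
              rcases hScases ⟨_, hdq⟩ with ⟨-, h⟩ | ⟨h, h'⟩
              · simp [h]
              · rw [← h1] at h'
                exact absurd h' h
            rw [hFdef, hS]
            omega)
        (ρ'.1 a ha) (by
          have h := ρ'.2 a ha
          simp only [Set.mem_ofPred_eq, h]
          exact ⟨ha, hna⟩) hhead
      have hnn := hnle a ha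
      have hF₀' := hF₀_nonneg (ρ'.1 a ha)
      rw [hFdef, ρ'.2 a ha] at hzero
      rcases hna with hna | hna
      · rcases hScases ⟨a, ha⟩ with ⟨h, -⟩ | ⟨-, h⟩
        · exact hna h
        · have : F₀ (ρ'.1 a ha) = 1 := if_pos ⟨_, h⟩
          omega
      · omega)
  refine Subtype.ext (funext fun u => funext fun hu => by_contra fun hne => ?_)
  have : u ∈ {u | ∃ hu : u ≠ q, ρ.1 u hu ≠ ρ'.1 u hu ∨ n u < 0} := ⟨hu, Or.inl hne⟩
  rw [hempty] at this
  exact this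

/-! ### The dual ribbon graph -/

lemma leftFace_next (d : G.D) : G.leftFace (G.next d) = G.rightFace d := by
  refine (Quotient.sound ⟨1, ?_⟩ : G.leftFace (G.rev d) = G.leftFace (G.next d)).symm
  show G.next (G.rev (G.rev d)) = G.next d
  rw [G.rev_invol]

lemma dual_next (d : G.D) : G.dual.next d = G.rev (G.next d) := by
  show G.rev (G.next (G.rev (G.rev d))) = _
  rw [G.rev_invol]

/-- A circulation supported on a spanning tree vanishes. -/
lemma circulation_eq_zero {T : Finset G.D} (hT : G.IsSpanningTree T) {z : G.D → ℤ}
    (hz : ∀ d, z (G.rev d) = -z d) (hzT : ∀ d, d ∉ T → z d = 0)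
    (hdiv : ∀ v, ∑ d ∈ Finset.univ.filter (fun d => G.tail d = v), z d = 0) (d : G.D) :
    z d = 0 := by
  obtain ⟨ρ, rk, hρ, hrk⟩ := G.exists_towardRoot hT (G.tail d)
  have hmem : ∀ d, d ∈ T → ∃ u hu, d = ρ.1 u hu ∨ d = G.rev (ρ.1 u hu) := by
    intro d hd
    rw [← hρ.rotorEdges_eq G hT] at hd
    exact G.mem_rotorEdges.1 hd
  have hrotor : ∀ u hu, z (ρ.1 u hu) = 0 := by
    by_contra! hne
    obtain ⟨u₀, hu₀, hne⟩ := hne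
    obtain ⟨u, ⟨hu, hzu⟩, hmax⟩ := Set.exists_max_image {u | ∃ hu, z (ρ.1 u hu) ≠ 0} rk
      (Set.toFinite _) ⟨u₀, hu₀, hne⟩
    have hd := hdiv u
    rw [Finset.sum_eq_single (ρ.1 u hu)] at hd
    · exact hzu hd
    · intro e he heu
      have hte : G.tail e = u := by simpa using he
      by_cases heT : e ∈ T
      · obtain ⟨w, hw, rfl | rfl⟩ := hmem e heT
        · obtain rfl : w = u := by rw [← hte, ρ.2 w hw]
          exact absurd rfl heu
        · rw [G.tail_rev] at hte
          by_contra hzw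
          have hlt := hrk w hw
          rw [hte] at hlt
          refine absurd (hmax w ⟨hw, fun h => hzw ?_⟩) (not_le.2 hlt)
          rw [hz, h, neg_zero]
      · exact hzT e heT
    · intro h
      exact (h (Finset.mem_filter.2 ⟨Finset.mem_univ _, ρ.2 u hu⟩)).elim
  by_cases hdT : d ∈ T
  · obtain ⟨u, hu, h | h⟩ := hmem d hdT
    · rw [h, hrotor]
    · rw [h, hz, hrotor, neg_zero]
  · exact hzT d hdT

/-- A set of faces closed under crossing the edges outside a spanning tree contains all faces as
soon as it contains one. -/
lemma faces_mem_of_closed (hconn : G.Connected) {T : Finset G.D} (hT : G.IsSpanningTree T)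
    (X : Set G.Faces) (hX : ∀ d, d ∉ T → G.rightFace d ∈ X → G.leftFace d ∈ X) {f : G.Faces}
    (hf : f ∈ X) (g : G.Faces) : g ∈ X := by
  let z : G.D → ℤ := fun d =>
    (if G.leftFace d ∈ X then 1 else 0) - if G.rightFace d ∈ X then 1 else 0
  have hrr : ∀ d, G.rightFace (G.rev d) = G.leftFace d := fun d =>
    congrArg G.leftFace (G.rev_invol d)
  have hz : ∀ d, z d = 0 := by
    refine circulation_eq_zero hT (fun d => ?_) (fun d hd => ?_) fun v => ?_
    · simp only [z, hrr]
      rw [show G.leftFace (G.rev d) = G.rightFace d from rfl]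
      ring
    · have h1 := hX d hd
      have h2 := hX (G.rev d) fun h => hd (by simpa [G.rev_invol d] using hT.1 _ h)
      rw [hrr] at h2
      exact sub_eq_zero.2 (if_congr ⟨h2, h1⟩ rfl rfl)
    · have h := Equiv.sum_comp G.next fun d =>
        if G.tail d = v then (if G.leftFace d ∈ X then (1 : ℤ) else 0) else 0
      simp only [G.next_tail, leftFace_next] at h
      simp only [z, Finset.sum_sub_distrib, Finset.sum_filter]
      rw [h, sub_self]
  have hiff : ∀ d, (G.leftFace d ∈ X) = (G.rightFace d ∈ X) := by
    intro d
    have := hz d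
    simp only [z] at this
    by_cases h1 : G.leftFace d ∈ X <;> by_cases h2 : G.rightFace d ∈ X <;> simp_all
  obtain ⟨d₀, rfl⟩ : ∃ d, G.leftFace d = f := Quotient.exists_rep f
  obtain ⟨d₁, rfl⟩ : ∃ d, G.leftFace d = g := Quotient.exists_rep g
  have hstar : ∀ d d', G.tail d = G.tail d' → (G.leftFace d ∈ X) = (G.leftFace d' ∈ X) :=
    fun d d' h => eq_of_tail_eq (fun d => G.leftFace d ∈ X)
      (fun d => by rw [leftFace_next, hiff]) h
  by_contra hg
  obtain ⟨d, ⟨d', hd', hmem⟩, hh⟩ := G.exists_dart_leaving hconn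
    {v | ∃ d, G.tail d = v ∧ G.leftFace d ∈ X} (u := G.tail d₀) (v := G.tail d₁) ⟨d₀, rfl, hf⟩
    (by rintro ⟨d, hd, hmem⟩; exact hg (hstar d d₁ hd ▸ hmem))
  refine hh ⟨G.rev d, G.tail_rev d, ?_⟩
  have : G.leftFace d ∈ X := hstar d' d hd' ▸ hmem
  exact hiff d ▸ this

lemma isSpanningTree_compl_dual (hconn : G.Connected) (hplanar : G.IsPlanar) (q : G.V) (f : G.Faces)
    {T : Finset G.D} (hT : G.IsSpanningTree T) : G.dual.IsSpanningTree Tᶜ := by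
  refine ⟨fun d hd => ?_, fun a b => ?_, ?_⟩
  · have hd' : d ∉ T := Finset.mem_compl.1 hd
    refine Finset.mem_compl.2 fun h => hd' ?_
    have := hT.1 _ h
    rwa [show G.rev (G.dual.rev d) = d from G.rev_invol d] at this
  · exact faces_mem_of_closed hconn hT
      {g | Relation.ReflTransGen (G.dual.treeAdj Tᶜ) a g}
      (fun d hd hr => Relation.ReflTransGen.tail hr ⟨d, Finset.mem_compl.2 hd, rfl, rfl⟩)
      Relation.ReflTransGen.refl b
  · show Tᶜ.card = 2 * (Fintype.card G.Faces - 1)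
    obtain ⟨k, hk⟩ := G.even_card_darts
    have h1 : Tᶜ.card = Fintype.card G.D - T.card := Finset.card_compl T
    have h2 := hT.2.2
    have h3 : 0 < Fintype.card G.V := Fintype.card_pos_iff.2 ⟨q⟩
    have h4 : 0 < Fintype.card G.Faces := Fintype.card_pos_iff.2 ⟨f⟩
    have h5 : Fintype.card G.V + Fintype.card G.Faces = Fintype.card G.D / 2 + 2 := hplanar
    omega

end RibbonGraph

/-- The rotor-routing action is compatible with plane duality:
for a planar ribbon graph `G` with `G` and `G*` loopless, for every
`[D] ∈ Jac(G)` and every spanning tree `T` of `G`,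
`δ([D]·T) = φ([D])·δ(T)` (for any choices of basepoints, the action being
basepoint-independent in the planar case). -/
theorem rotor_routing_compatible_with_duality (G : RibbonGraph)
    (hconn : G.Connected) (hloop : G.Loopless) (hplanar : G.IsPlanar)
    (hdualloop : G.dual.Loopless)
    (φ : G.Jac ≃+ G.dual.Jac)
    (hφ : ∀ d : G.D, φ (G.dartBoundary d) = G.dual.dartBoundary d)
    (q : G.V) (qd : G.dual.V)
    (x : G.Jac) (T : Finset G.D) (hT : G.IsSpanningTree T) :
    (G.rotorAction q x T)ᶜ = G.dual.rotorAction qd (φ x) Tᶜ := by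
  have hT' := RibbonGraph.rotorAction_spec hconn hloop q x hT
  set T' := G.rotorAction q x T
  have hTd := RibbonGraph.isSpanningTree_compl_dual hconn hplanar q qd hT
  have hTd' := RibbonGraph.isSpanningTree_compl_dual hconn hplanar q qd hT'.1
  obtain ⟨hS, hSact⟩ := RibbonGraph.rotorAction_spec
    (hTd.connected) hdualloop qd (φ x) hTd
  set S := G.dual.rotorAction qd (φ x) Tᶜ
  let h : G.D → G.dual.Jac := fun d => G.dual.unitClass (G.rightFace d) qd
  let hd : G.D → G.dual.Jac := fun d => φ (G.unitClass (G.tail d) q)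
  have hh : ∀ d, φ (G.dartBoundary (G.next d)) = h d - h (G.next d) := by
    intro d
    refine (hφ _).trans (Eq.trans ?_ (G.dual.unitClass_sub _ _ qd).symm)
    exact congrArg (fun f => G.dual.unitClass f (G.rightFace (G.next d)))
      (RibbonGraph.leftFace_next d)
  have hhd : ∀ d, G.dual.dartBoundary (G.dual.next d) = hd d - hd (G.dual.next d) := by
    intro (d : G.D)
    have h1 : G.dual.dartBoundary (G.rev (G.next d)) = hd d - hd (G.rev (G.next d)) := by
      refine (hφ _).symm.trans (Eq.trans (congrArg φ ?_) (map_sub φ _ _))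
      refine Eq.trans ?_ (G.unitClass_sub _ _ q).symm
      rw [← G.next_tail d]
      rfl
    rw [← RibbonGraph.dual_next d] at h1
    exact h1
  let ψ : G.D → G.dual.Jac := fun d => hd d - h d
  have hψ : ∀ d, ψ (G.rev d) = ψ d := by
    intro d
    have h1 : hd (G.rev d) - hd d = G.dual.dartBoundary d := by
      rw [← hφ, ← map_sub, Multigraph.unitClass_sub, G.tail_rev]
      rfl
    have h2 : h (G.rev d) - h d = G.dual.dartBoundary d := by
      exact (G.dual.unitClass_sub (G.rightFace (G.rev d)) (G.rightFace d) qd).trans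
        (congrArg (fun f => G.dual.unitClass f (G.rightFace d))
          (congrArg G.leftFace (G.rev_invol d)))
    have h3 := h1.trans h2.symm
    rw [sub_eq_sub_iff_add_eq_add] at h3
    rw [sub_eq_sub_iff_add_eq_add, h3, add_comm]
  obtain ⟨O, hO⟩ := G.exists_orientation
  let Ψ : Finset G.D → G.dual.Jac := fun U => ∑ d ∈ U, if O d then ψ d else 0
  have hΨ : ∀ {U : Finset G.D} (ρ : G.RotorConfig q), G.IsSpanningTree U → G.TowardRoot q U ρ →
      ∑ u : {u // u ≠ q}, h (ρ.1 u u.2) =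
        ∑ u : {u // u ≠ q}, φ (G.unitClass u q) - Ψ U := by
    intro U ρ hU hρ
    have := G.sum_rotors_eq_sum_rotorEdges hρ.leadsToRoot hO hψ
    rw [hρ.rotorEdges_eq G hU, Finset.sum_sub_distrib] at this
    have h1 : ∑ u : {u // u ≠ q}, hd (ρ.1 u u.2) = ∑ u : {u // u ≠ q}, φ (G.unitClass u q) :=
      Finset.sum_congr rfl fun u _ => congrArg (fun v => φ (G.unitClass v q)) (ρ.2 u u.2)
    rw [← h1]
    exact eq_sub_of_add_eq (sub_eq_iff_eq_add'.1 this).symm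
  have hΨd : ∀ {U : Finset G.D} (σ : G.dual.RotorConfig qd), G.dual.IsSpanningTree U →
      G.dual.TowardRoot qd U σ →
      ∑ u : {u // u ≠ qd}, hd (σ.1 u u.2) =
        ∑ u : {u // u ≠ qd}, G.dual.unitClass u qd + Ψ U := by
    intro U σ hU hσ
    have := G.dual.sum_rotors_eq_sum_rotorEdges hσ.leadsToRoot hO hψ
    rw [hσ.rotorEdges_eq G.dual hU, Finset.sum_sub_distrib, sub_eq_iff_eq_add'] at this
    rw [this]
    congr 1
    exact Finset.sum_congr rfl fun u _ =>
      congrArg (fun v => G.dual.unitClass v qd) (σ.2 u u.2)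
  obtain ⟨ρ, ρ', hρ, hρ', hx⟩ := hT'.2.exists_rotors φ.toAddMonoidHom h hh
  obtain ⟨σ, σ', hσ, hσ', hy⟩ := hSact.exists_rotors (AddMonoidHom.id _) hd hhd
  obtain ⟨τ, -, hτ, -⟩ := G.dual.exists_towardRoot hTd' qd
  have hcompl : ∀ U : Finset G.D, Ψ U + Ψ Uᶜ = Ψ Finset.univ := fun U => Finset.sum_add_sum_compl U _
  have hx' : φ x = Ψ T - Ψ T' := by
    rw [hΨ ρ hT hρ, hΨ ρ' hT'.1 hρ'] at hx
    have h1 : φ x = _ := (eq_sub_of_add_eq hx.symm)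
    rw [h1]
    abel
  have hστ : σ' = τ := by
    refine RibbonGraph.rotors_eq_of_sum_eq hdualloop hhd hσ'.leadsToRoot hτ.leadsToRoot ?_
    have halg : ∀ {z a y s p t t' c c' : G.dual.Jac}, z = a + y → y = s + c → a = t - t' →
        t + c = p → t' + c' = p → z = s + c' := by
      rintro z a y s p t t' c c' rfl rfl rfl h rfl
      rw [← eq_sub_iff_add_eq'] at h
      rw [h]
      abel
    exact (halg hy (hΨd σ hTd hσ) hx' (hcompl T) (hcompl T')).trans (hΨd τ hTd' hτ).symm
  rw [← hσ'.rotorEdges_eq G.dual hS, hστ]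
  exact (hτ.rotorEdges_eq G.dual hTd').symm
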